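/- Let D be a nonempty bounded convex open subset of a finite-dimensional real normed vector space with Hilbert metric d_H satisfying condition (D), let F : D → D be nonexpansive with respect to d_H, and let λ > 0. Then the resolvent R_λ : D → D of F is nonexpansive with respect to d_H: d_H(R_λ(x), R_λ(y)) ≤ d_H(x,y) for all x, y ∈ D. -/

import Mathlib

/-- `d` is the Hilbert (cross-ratio) metric on the bounded convex open set `D`:
`d x x = 0` on `D`, and for distinct `x y ∈ D` there are boundary points `a b ∈ ∂D`
with `x` between `a` and `y`, `y` between `x` and `b`, and
`d x y = log ((‖y−a‖ ‖x−b‖)/(‖x−a‖ ‖y−b‖))`. -/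
def IsHilbertMetric {V : Type*} [NormedAddCommGroup V] [NormedSpace ℝ V]
    (D : Set V) (d : V → V → ℝ) : Prop :=
  (∀ x ∈ D, d x x = 0) ∧
  ∀ x ∈ D, ∀ y ∈ D, x ≠ y →
    ∃ a ∈ frontier D, ∃ b ∈ frontier D,
      x ∈ segment ℝ a y ∧ y ∈ segment ℝ x b ∧
      d x y = Real.log ((‖y - a‖ * ‖x - b‖) / (‖x - a‖ * ‖y - b‖))

open Filter Topology

section HilbertMetric

variable {V : Type*} [NormedAddCommGroup V] [NormedSpace ℝ V] {D : Set V} {d : V → V → ℝ}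

/-- A ray issuing from a point of a convex open set does not return to the closure of the set after
meeting its frontier. -/
lemma Convex.le_of_ray_mem_frontier (hDo : IsOpen D) (hDc : Convex ℝ D) {x h : V} (hx : x ∈ D)
    {p r : ℝ} (hp : 0 < p) (hpf : x + p • h ∈ frontier D) (hr : x + r • h ∈ closure D) :
    r ≤ p := by
  by_contra! hlt
  have hr0 : 0 < r := hp.trans hlt
  have hmem : x + p • h ∈ openSegment ℝ x (x + r • h) := by
    refine ⟨1 - p / r, p / r, ?_, by positivity, by ring, ?_⟩
    · rw [sub_pos, div_lt_one hr0]; exact hlt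
    · rw [smul_add, smul_smul, div_mul_cancel₀ _ hr0.ne', ← add_assoc, ← add_smul]
      simp
  have hint := hDc.openSegment_interior_closure_subset_interior
    (hDo.interior_eq.symm ▸ hx) hr hmem
  exact hpf.2 hint

/-- If `x` lies between the frontier point `a` and `y ≠ x`, then `a` is a positive multiple of
`x - y` away from `x`. -/
lemma exists_pos_eq_add_smul_of_mem_segment (hDo : IsOpen D) {x y a : V} (hx : x ∈ D)
    (hxy : x ≠ y) (ha : a ∈ frontier D) (h : x ∈ segment ℝ a y) :
    ∃ p : ℝ, 0 < p ∧ a = x + p • (x - y) := by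
  obtain ⟨α, β, hα, hβ, hs, rfl⟩ := h
  have hα0 : α ≠ 0 := by
    rintro rfl
    simp_all
  have hβ0 : β ≠ 0 := by
    rintro rfl
    obtain rfl : α = 1 := by linarith
    rw [hDo.frontier_eq] at ha
    exact ha.2 (by simpa using hx)
  refine ⟨β / α, by positivity, ?_⟩
  obtain rfl : β = 1 - α := by linarith
  match_scalars <;> field_simp <;> ring

/-- The Hilbert metric in terms of affine parameters on the line through two points. -/
lemma IsHilbertMetric.exists_exp_eq (hDo : IsOpen D) (hd : IsHilbertMetric D d) {x y : V}
    (hx : x ∈ D) (hy : y ∈ D) (hxy : x ≠ y) :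
    ∃ p q : ℝ, 0 < p ∧ 0 < q ∧ x + p • (x - y) ∈ frontier D ∧ y + q • (y - x) ∈ frontier D ∧
      Real.exp (d x y) = (1 + 1 / p) * (1 + 1 / q) := by
  obtain ⟨a, ha, b, hb, hxa, hyb, hdxy⟩ := hd.2 x hx y hy hxy
  rw [segment_symm] at hyb
  obtain ⟨p, hp, rfl⟩ := exists_pos_eq_add_smul_of_mem_segment hDo hx hxy ha hxa
  obtain ⟨q, hq, rfl⟩ := exists_pos_eq_add_smul_of_mem_segment hDo hy hxy.symm hb hyb
  refine ⟨p, q, hp, hq, ha, hb, ?_⟩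
  have hn : 0 < ‖x - y‖ := norm_pos_iff.2 (sub_ne_zero.2 hxy)
  have h1 : ‖y - (x + p • (x - y))‖ = (1 + p) * ‖x - y‖ := by
    rw [show y - (x + p • (x - y)) = (-(1 + p)) • (x - y) by module, norm_smul, norm_neg,
      Real.norm_of_nonneg (by positivity)]
  have h2 : ‖x - (y + q • (y - x))‖ = (1 + q) * ‖x - y‖ := by
    rw [show x - (y + q • (y - x)) = (1 + q) • (x - y) by module, norm_smul,
      Real.norm_of_nonneg (by positivity)]
  have h3 : ‖x - (x + p • (x - y))‖ = p * ‖x - y‖ := by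
    rw [show x - (x + p • (x - y)) = (-p) • (x - y) by module, norm_smul, norm_neg,
      Real.norm_of_nonneg hp.le]
  have h4 : ‖y - (y + q • (y - x))‖ = q * ‖x - y‖ := by
    rw [show y - (y + q • (y - x)) = q • (x - y) by module, norm_smul,
      Real.norm_of_nonneg hq.le]
  rw [hdxy, h1, h2, h3, h4, Real.exp_log (by positivity)]
  field_simp
  ring

lemma IsHilbertMetric.nonneg (hDo : IsOpen D) (hd : IsHilbertMetric D d) {x y : V}
    (hx : x ∈ D) (hy : y ∈ D) : 0 ≤ d x y := by
  rcases eq_or_ne x y with rfl | hxy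
  · exact (hd.1 x hx).ge
  · obtain ⟨p, q, hp, hq, -, -, he⟩ := hd.exists_exp_eq hDo hx hy hxy
    rw [← Real.exp_le_exp, Real.exp_zero, he]
    exact one_le_mul_of_one_le_of_one_le (by simp [hp.le]) (by simp [hq.le])

/-- On a bounded domain the Hilbert metric dominates the norm. -/
lemma IsHilbertMetric.norm_sub_le (hDo : IsOpen D) (hd : IsHilbertMetric D d) {M : ℝ}
    (hM : ∀ c ∈ closure D, ∀ z ∈ D, ‖c - z‖ ≤ M) {x y : V} (hx : x ∈ D) (hy : y ∈ D) :
    ‖x - y‖ ≤ M * (Real.exp (d x y) - 1) := by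
  rcases eq_or_ne x y with rfl | hxy
  · simp [hd.1 x hx]
  · obtain ⟨p, q, hp, hq, ha, -, he⟩ := hd.exists_exp_eq hDo hx hy hxy
    have h1 := hM _ ha.1 x hx
    rw [add_sub_cancel_left, norm_smul, Real.norm_of_nonneg hp.le] at h1
    have hM0 : 0 ≤ M := le_trans (by positivity) h1
    rw [he]
    calc ‖x - y‖ = (p * ‖x - y‖) * (1 / p) := by field_simp
      _ ≤ M * (1 / p) := by gcongr
      _ ≤ M * ((1 + 1 / p) * (1 + 1 / q) - 1) := by
        gcongr
        have : 0 < 1 / p := by positivity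
        have : 0 < 1 / q := by positivity
        nlinarith [mul_pos ‹0 < 1 / p› this]

/-- A homothety of ratio `1 - s < 1` centred in `D` contracts `exp d - 1`. -/
lemma IsHilbertMetric.exists_contraction (hDo : IsOpen D) (hDc : Convex ℝ D)
    (hd : IsHilbertMetric D d) {M : ℝ} (hM : ∀ c ∈ closure D, ∀ z ∈ D, ‖c - z‖ ≤ M)
    {x : V} (hx : x ∈ D) {s : ℝ} (hs0 : 0 < s) (hs1 : s < 1) :
    ∃ k : ℝ, 0 ≤ k ∧ k < 1 ∧ ∀ z ∈ D, ∀ w ∈ D,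
      Real.exp (d (s • x + (1 - s) • z) (s • x + (1 - s) • w)) - 1
        ≤ k * (Real.exp (d z w) - 1) := by
  have hM0 : 0 ≤ M := (norm_nonneg _).trans (hM x (subset_closure hx) x hx)
  obtain ⟨ε, hε, hball⟩ := Metric.isOpen_iff.1 hDo x hx
  set δ : ℝ := ε / (M + 1) with hδ
  have hδ0 : 0 < δ := by positivity
  have hδD : ∀ c ∈ closure D, ∀ z ∈ D, x + δ • (c - z) ∈ D := fun c hc z hz ↦ by
    apply hball
    rw [mem_ball_iff_norm, add_sub_cancel_left, norm_smul, Real.norm_of_nonneg hδ0.le, hδ,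
      div_mul_eq_mul_div, div_lt_iff₀ (by positivity)]
    gcongr
    linarith [hM c hc z hz]
  have hs1' : 0 < 1 - s := sub_pos.2 hs1
  set m : ℝ := 1 + s * δ / (1 - s) with hm
  have hm1 : 1 < m := by rw [hm]; linarith [show 0 < s * δ / (1 - s) by positivity]
  have hm0 : 0 < m := one_pos.trans hm1
  have hmem : ∀ z ∈ D, s • x + (1 - s) • z ∈ D := fun z hz ↦
    hDc hx hz hs0.le hs1'.le (by ring)
  have key : ∀ z ∈ D, ∀ w : V, ∀ p p' : ℝ, 0 < p → 0 < p' → z + p • (z - w) ∈ frontier D →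
      (s • x + (1 - s) • z) + p' • ((s • x + (1 - s) • z) - (s • x + (1 - s) • w)) ∈ frontier D →
      1 / p' ≤ 1 / m * (1 / p) := by
    intro z hz w p p' hp hp' h h'
    have hle : m * p ≤ p' := by
      refine hDc.le_of_ray_mem_frontier hDo (hmem z hz) hp' h' ?_
      have := hDc.closure (subset_closure (hδD _ h.1 z hz)) h.1 hs0.le hs1'.le (by ring)
      convert this using 1
      rw [hm]
      match_scalars <;> field_simp <;> ring
    rw [one_div_mul_one_div]
    exact one_div_le_one_div_of_le (by positivity) hle
  refine ⟨1 / m, by positivity, by rw [div_lt_one hm0]; exact hm1, fun z hz w hw ↦ ?_⟩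
  rcases eq_or_ne z w with rfl | hzw
  · simp [hd.1 z hz, hd.1 _ (hmem z hz)]
  have hzw' : s • x + (1 - s) • z ≠ s • x + (1 - s) • w := fun h ↦
    hzw (smul_right_injective V hs1'.ne' (add_left_cancel h))
  obtain ⟨p, q, hp, hq, ha, hb, he⟩ := hd.exists_exp_eq hDo hz hw hzw
  obtain ⟨p', q', hp', hq', ha', hb', he'⟩ := hd.exists_exp_eq hDo (hmem z hz) (hmem w hw) hzw'
  have hpp := key z hz w p p' hp hp' ha ha'
  have hqq := key w hw z q q' hq hq' hb hb'
  rw [he, he']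
  have hk0 : 0 < 1 / m := by positivity
  have hk1 : 1 / m ≤ 1 := by rw [div_le_one hm0]; exact hm1.le
  have hP : 0 < 1 / p := by positivity
  have hQ : 0 < 1 / q := by positivity
  calc (1 + 1 / p') * (1 + 1 / q') - 1
      ≤ (1 + 1 / m * (1 / p)) * (1 + 1 / m * (1 / q)) - 1 := by gcongr
    _ = 1 / m * (1 / p + 1 / q + 1 / m * (1 / p * (1 / q))) := by ring
    _ ≤ 1 / m * (1 / p + 1 / q + 1 * (1 / p * (1 / q))) := by gcongr
    _ = 1 / m * ((1 + 1 / p) * (1 + 1 / q) - 1) := by ring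

/-- The Hilbert metric is lower semicontinuous. -/
lemma IsHilbertMetric.le_of_tendsto (hDo : IsOpen D) (hDc : Convex ℝ D)
    (hd : IsHilbertMetric D d) {z w : ℕ → V} {u v : V} {r : ℝ}
    (hz : ∀ n, z n ∈ D) (hw : ∀ n, w n ∈ D) (hu : u ∈ D) (hv : v ∈ D)
    (hzu : Tendsto z atTop (𝓝 u)) (hwv : Tendsto w atTop (𝓝 v))
    (hr : ∀ n, d (z n) (w n) ≤ r) : d u v ≤ r := by
  rcases eq_or_ne u v with rfl | huv
  · rw [hd.1 u hu]
    exact (hd.nonneg hDo (hz 0) (hw 0)).trans (hr 0)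
  obtain ⟨p, q, hp, hq, ha, hb, he⟩ := hd.exists_exp_eq hDo hu hv huv
  have key : ∀ {z w : ℕ → V} {u v : V} {p η : ℝ}, (∀ n, z n ∈ D) → u ∈ D →
      Tendsto z atTop (𝓝 u) → Tendsto w atTop (𝓝 v) → 0 < p → 0 < η →
      u + p • (u - v) ∈ frontier D →
      ∀ᶠ n in atTop, ∀ p', 0 < p' → z n + p' • (z n - w n) ∈ frontier D → p' ≤ p + η := by
    intro z w u v p η hz hu hzu hwv hp hη h
    have hnot : u + (p + η) • (u - v) ∈ (closure D)ᶜ := fun hc ↦ by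
      linarith [hDc.le_of_ray_mem_frontier hDo hu hp h hc]
    have ht : Tendsto (fun n ↦ z n + (p + η) • (z n - w n)) atTop
        (𝓝 (u + (p + η) • (u - v))) := hzu.add ((hzu.sub hwv).const_smul _)
    filter_upwards [ht.eventually (isClosed_closure.isOpen_compl.mem_nhds hnot)] with n hn p' hp' h'
    by_contra! hlt
    refine hn ?_
    have := hDc.closure.add_smul_mem (subset_closure (hz n)) h'.1
      (t := (p + η) / p') ⟨by positivity, (div_le_one hp').2 hlt.le⟩
    rwa [smul_smul, div_mul_cancel₀ _ hp'.ne'] at this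
  have hη : ∀ η : ℝ, 0 < η → (1 + 1 / (p + η)) * (1 + 1 / (q + η)) ≤ Real.exp r := by
    intro η hη
    obtain ⟨n, hn1, hn2, hne⟩ := ((key hz hu hzu hwv hp hη ha).and
      ((key hw hv hwv hzu hq hη hb).and ((hzu.prodMk_nhds hwv).eventually
        ((isOpen_ne_fun continuous_fst continuous_snd).mem_nhds
          (show (u, v) ∈ {a : V × V | a.1 ≠ a.2} from huv))))).exists
    obtain ⟨p', q', hp', hq', ha', hb', he'⟩ := hd.exists_exp_eq hDo (hz n) (hw n) hne
    have h1 := hn1 p' hp' ha'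
    have h2 := hn2 q' hq' hb'
    calc _ ≤ (1 + 1 / p') * (1 + 1 / q') := by gcongr
      _ = Real.exp (d (z n) (w n)) := he'.symm
      _ ≤ Real.exp r := Real.exp_le_exp.2 (hr n)
  rw [← Real.exp_le_exp, he]
  have hcont : ContinuousAt (fun η : ℝ ↦ (1 + 1 / (p + η)) * (1 + 1 / (q + η))) 0 := by
    have : p + 0 ≠ 0 := by simpa using hp.ne'
    have : q + 0 ≠ 0 := by simpa using hq.ne'
    fun_prop (disch := assumption)
  have ht := hcont.tendsto.mono_left (nhdsWithin_le_nhds (s := Set.Ioi 0))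
  simp only [add_zero] at ht
  exact _root_.le_of_tendsto ht (eventually_mem_nhdsWithin.mono hη)

/-- The Picard iterates of `z ↦ s • x + (1 - s) • F z` converge to any fixed point of this map. -/
lemma IsHilbertMetric.tendsto_iterate (hDo : IsOpen D) (hDc : Convex ℝ D)
    (hd : IsHilbertMetric D d) {M : ℝ} (hM : ∀ c ∈ closure D, ∀ z ∈ D, ‖c - z‖ ≤ M)
    {F : V → V} (hF : ∀ y ∈ D, F y ∈ D) (hFd : ∀ x ∈ D, ∀ y ∈ D, d (F x) (F y) ≤ d x y)
    {s : ℝ} (hs0 : 0 < s) (hs1 : s < 1) {x u : V} (hx : x ∈ D) (hu : u ∈ D)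
    (hfix : u = s • x + (1 - s) • F u) {z : ℕ → V} (hz : ∀ n, z n ∈ D)
    (hrec : ∀ n, z (n + 1) = s • x + (1 - s) • F (z n)) : Tendsto z atTop (𝓝 u) := by
  obtain ⟨k, hk0, hk1, hk⟩ := hd.exists_contraction hDo hDc hM hx hs0 hs1
  have hM0 : 0 ≤ M := (norm_nonneg _).trans (hM x (subset_closure hx) x hx)
  have hgeom : ∀ n, Real.exp (d (z n) u) - 1 ≤ k ^ n * (Real.exp (d (z 0) u) - 1) := by
    intro n
    induction n with
    | zero => simp
    | succ n ih =>
      calc Real.exp (d (z (n + 1)) u) - 1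
          ≤ k * (Real.exp (d (F (z n)) (F u)) - 1) := by
            rw [hrec n]
            nth_rewrite 1 [hfix]
            exact hk _ (hF _ (hz n)) _ (hF _ hu)
        _ ≤ k * (Real.exp (d (z n) u) - 1) := by
            gcongr
            exact hFd _ (hz n) _ hu
        _ ≤ k * (k ^ n * (Real.exp (d (z 0) u) - 1)) := by gcongr
        _ = _ := by ring
  rw [tendsto_iff_norm_sub_tendsto_zero]
  refine squeeze_zero (fun _ ↦ norm_nonneg _)
    (fun n ↦ (hd.norm_sub_le hDo hM (hz n) hu).trans
      (mul_le_mul_of_nonneg_left (hgeom n) hM0)) ?_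
  simpa using ((tendsto_pow_atTop_nhds_zero_of_lt_one hk0 hk1).mul_const
    (Real.exp (d (z 0) u) - 1)).const_mul M

end HilbertMetric

theorem resolvent_nonexpansive
    {V : Type*} [NormedAddCommGroup V] [NormedSpace ℝ V] [FiniteDimensional ℝ V]
    (D : Set V) (hDo : IsOpen D) (hDc : Convex ℝ D) (hDb : Bornology.IsBounded D)
    (hDn : D.Nonempty)
    (dH : V → V → ℝ) (hdH : IsHilbertMetric D dH)
    (hcondD : ∀ x ∈ D, ∀ y ∈ D, ∀ z ∈ D, ∀ w ∈ D, ∀ s ∈ Set.Icc (0 : ℝ) 1,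
      dH (s • x + (1 - s) • y) (s • z + (1 - s) • w) ≤ max (dH x z) (dH y w))
    (F : V → V) (hFmaps : ∀ y ∈ D, F y ∈ D)
    (hFne : ∀ x ∈ D, ∀ y ∈ D, dH (F x) (F y) ≤ dH x y)
    (lam : ℝ) (hlam : 0 < lam)
    (R : V → V)
    (hR : ∀ x ∈ D, R x ∈ D ∧ R x = (1 / (1 + lam)) • x + (lam / (1 + lam)) • F (R x)) :
    ∀ x ∈ D, ∀ y ∈ D, dH (R x) (R y) ≤ dH x y := by
  intro x hx y hy
  obtain ⟨C, hC⟩ := Metric.isBounded_iff.1 hDb.closure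
  have hM : ∀ c ∈ closure D, ∀ z ∈ D, ‖c - z‖ ≤ C := fun c hc z hz ↦ by
    simpa [dist_eq_norm] using hC hc (subset_closure hz)
  set s : ℝ := 1 / (1 + lam) with hs
  have hs0 : 0 < s := by positivity
  have hs1 : s < 1 := by rw [hs, div_lt_one (by positivity)]; linarith
  have hs' : lam / (1 + lam) = 1 - s := by rw [hs]; field_simp; ring
  rw [hs'] at hR
  have hmem : ∀ x ∈ D, ∀ n, (fun z ↦ s • x + (1 - s) • F z)^[n] x ∈ D := by
    intro x hx n
    induction n with
    | zero => exact hx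
    | succ n ih =>
      rw [Function.iterate_succ_apply']
      exact hDc hx (hFmaps _ ih) hs0.le (sub_pos.2 hs1).le (by ring)
  have hlim : ∀ x ∈ D, Tendsto (fun n ↦ (fun z ↦ s • x + (1 - s) • F z)^[n] x) atTop
      (𝓝 (R x)) := fun x hx ↦
    hdH.tendsto_iterate hDo hDc hM hFmaps hFne hs0 hs1 hx (hR x hx).1 (hR x hx).2 (hmem x hx)
      fun n ↦ Function.iterate_succ_apply' _ n x
  refine hdH.le_of_tendsto hDo hDc (hmem x hx) (hmem y hy) (hR x hx).1 (hR y hy).1 (hlim x hx)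
    (hlim y hy) fun n ↦ ?_
  induction n with
  | zero => exact le_rfl
  | succ n ih =>
    rw [Function.iterate_succ_apply', Function.iterate_succ_apply']
    refine (hcondD x hx _ (hFmaps _ (hmem x hx n)) y hy _ (hFmaps _ (hmem y hy n)) s
      ⟨hs0.le, hs1.le⟩).trans (max_le le_rfl ?_)
    exact (hFne _ (hmem x hx n) _ (hmem y hy n)).trans ih
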